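/- arXiv:2106.03539 — 2 statements merged into one kernel-verified Lean document; each statement's English description precedes it below -/
import Mathlib

section
/- In the n-qubit net, for any ordered pair of safe markings m, m': if m ≠ m' there is exactly one concurrence t with m →_t m', namely the multiset containing u_i for each position i where the bit changes from 0 to 1 and d_i for each position i where it changes from 1 to 0, and no other transitions; if m = m', the empty concurrence is the only concurrence t with m →_t m. -/
/-- A Place-Transition net: flow functions giving each transition its
input and output multiset of places. -/
structure PTN (P T : Type) where
  Fminus : T → Multiset P
  Fplus : T → Multiset P

namespace PTN

variable {P T : Type} [DecidableEq P]

/-- Input flow of a concurrence (multiset of transitions), extended additively. -/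
def inFlow (N : PTN P T) (t : Multiset T) : Multiset P := (t.map N.Fminus).sum

/-- Output flow of a concurrence, extended additively. -/
def outFlow (N : PTN P T) (t : Multiset T) : Multiset P := (t.map N.Fplus).sum

/-- `N.Fires m t m'` : concurrence `t` is enabled at marking `m` and firing it yields `m'`. -/
def Fires (N : PTN P T) (m : Multiset P) (t : Multiset T) (m' : Multiset P) : Prop :=
  N.inFlow t ≤ m ∧ m' = m - N.inFlow t + N.outFlow t

/-- Direct single-transition reachability: firing some concurrence of cardinality 1. -/
def Step1 (N : PTN P T) (m m' : Multiset P) : Prop :=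
  ∃ t : Multiset T, Multiset.card t = 1 ∧ N.Fires m t m'

/-- Reachability set of the system net `(N, M0)`. -/
def ReachSet (N : PTN P T) (M0 : Multiset P) : Set (Multiset P) :=
  {m | Relation.ReflTransGen N.Step1 M0 m}

/-- Entry `R_Q[m', m]` of the rate matrix: sum of `r m t` over all concurrences `t`
with `m →_t m'`. -/
noncomputable def rateEntry (N : PTN P T) (r : Multiset P → Multiset T → ℂ)
    (m m' : Multiset P) : ℂ :=
  ∑ᶠ t ∈ {t : Multiset T | N.Fires m t m'}, r m t

end PTN

/-- The `n`-qubit net: places `(i, b)` for `i < n`, `b : Bool`; the transition `(i, b)`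
moves the token of qubit `i` from `(i, b)` to `(i, !b)` (so `(i, false)` is `u_i` and
`(i, true)` is `d_i`). -/
def qubitNet (n : ℕ) : PTN (Fin n × Bool) (Fin n × Bool) where
  Fminus := fun t => {t}
  Fplus := fun t => {(t.1, !t.2)}

/-- The safe marking corresponding to the bit string `b : Fin n → Bool`. -/
def safeMarking {n : ℕ} (b : Fin n → Bool) : Multiset (Fin n × Bool) :=
  Finset.univ.val.map fun i => (i, b i)

/-- The concurrence switching the safe marking of `b` to the safe marking of `b'`:
it contains, for each position `i` where the bit changes, the transition `(i, b i)`
(which is `u_i` if the bit changes from 0 to 1 and `d_i` if it changes from 1 to 0),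
and no other transitions. For `b = b'` it is the empty concurrence. -/
def switchConc {n : ℕ} (b b' : Fin n → Bool) : Multiset (Fin n × Bool) :=
  (Finset.univ.filter fun i => b i ≠ b' i).val.map fun i => (i, b i)

theorem count_map_univ_filter_graph {n : ℕ} (p : Fin n → Prop) [DecidablePred p]
    (b : Fin n → Bool) (i : Fin n) (x : Bool) :
    ((Finset.univ.filter p).val.map fun j => (j, b j)).count (i, x) =
      if p i ∧ b i = x then 1 else 0 := by
  have hinj : Function.Injective fun j => (j, b j) := fun j k h => congrArg Prod.fst h
  rw [Multiset.count_eq_of_nodup ((Finset.nodup _).map hinj)]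
  refine if_congr ?_ rfl rfl
  simp only [Multiset.mem_map, Finset.mem_val, Finset.mem_filter, Finset.mem_univ, true_and,
    Prod.mk.injEq]
  constructor
  · rintro ⟨j, hp, rfl, hb⟩
    exact ⟨hp, hb⟩
  · rintro ⟨hp, hb⟩
    exact ⟨i, hp, rfl, hb⟩

theorem count_safeMarking {n : ℕ} (b : Fin n → Bool) (i : Fin n) (x : Bool) :
    (safeMarking b).count (i, x) = if b i = x then 1 else 0 := by
  simpa [safeMarking] using count_map_univ_filter_graph (fun _ => True) b i x

theorem count_switchConc {n : ℕ} (b b' : Fin n → Bool) (i : Fin n) (x : Bool) :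
    (switchConc b b').count (i, x) = if b i ≠ b' i ∧ b i = x then 1 else 0 :=
  count_map_univ_filter_graph (fun j => b j ≠ b' j) b i x

theorem qubitNet_inFlow {n : ℕ} (t : Multiset (Fin n × Bool)) : (qubitNet n).inFlow t = t :=
  Multiset.sum_map_singleton t

theorem count_qubitNet_outFlow {n : ℕ} (t : Multiset (Fin n × Bool)) (i : Fin n) (x : Bool) :
    ((qubitNet n).outFlow t).count (i, x) = t.count (i, !x) := by
  have hinj : Function.Injective fun q : Fin n × Bool => (q.1, !q.2) := by
    rintro ⟨j, y⟩ ⟨k, z⟩ h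
    simpa using h
  have hflow : (qubitNet n).outFlow t = t.map fun q => (q.1, !q.2) := by
    rw [← Multiset.sum_map_singleton (t.map _), Multiset.map_map]
    rfl
  rw [hflow]
  simpa using Multiset.count_map_eq_count' _ t hinj (i, !x)

theorem qubitNet_fires_iff_count {n : ℕ} (m t m' : Multiset (Fin n × Bool)) :
    (qubitNet n).Fires m t m' ↔ ∀ i x, t.count (i, x) ≤ m.count (i, x) ∧
      m'.count (i, x) = m.count (i, x) - t.count (i, x) + t.count (i, !x) := by
  simp only [PTN.Fires, qubitNet_inFlow, Multiset.le_iff_count, Multiset.ext, Prod.forall,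
    Multiset.count_add, Multiset.count_sub, count_qubitNet_outFlow, forall_and]

/-- **Unique concurrence between safe markings of the `n`-qubit net.** For any ordered
pair of safe markings (given by bit strings `b`, `b'`), a concurrence `t` fires from
`safeMarking b` to `safeMarking b'` if and only if `t = switchConc b b'`; in particular
if `b ≠ b'` there is exactly one such concurrence, consisting of `u_i` for each bit
changing 0→1 and `d_i` for each bit changing 1→0, and if `b = b'` the empty concurrence
(`switchConc b b = 0`) is the only one. -/
theorem qubitNet_fires_iff (n : ℕ) (b b' : Fin n → Bool) :
    (∀ t : Multiset (Fin n × Bool),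
      (qubitNet n).Fires (safeMarking b) t (safeMarking b') ↔ t = switchConc b b') ∧
    switchConc b b = 0 := by
  refine ⟨fun t => ?_, by simp [switchConc]⟩
  simp only [qubitNet_fires_iff_count, Multiset.ext, Prod.forall, count_safeMarking,
    count_switchConc]
  refine forall_congr' fun i => ?_
  simp only [Bool.forall_bool, Bool.not_false, Bool.not_true]
  generalize t.count (i, false) = u
  generalize t.count (i, true) = d
  cases b i <;> cases b' i <;> simp <;> omega
end

section
/- Step characterization of juxtaposed nets: let N and N' be PTNs and form their juxtaposition. Every concurrence of the juxtaposition splits uniquely as t·t' with t a concurrence over T and t' a concurrence over T', every marking splits uniquely as m·m', and (m₁·m₁') →_{t·t'} (m₂·m₂') holds in the juxtaposition if and only if m₁ →_t m₂ holds in N and m₁' →_{t'} m₂' holds in N'. -/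
/-- Juxtaposition (disjoint parallel composition) of two PTNs. -/
def PTN.juxta {P T P' T' : Type} (N : PTN P T) (N' : PTN P' T') : PTN (P ⊕ P') (T ⊕ T') where
  Fminus := Sum.elim (fun t => (N.Fminus t).map Sum.inl) (fun t => (N'.Fminus t).map Sum.inr)
  Fplus := Sum.elim (fun t => (N.Fplus t).map Sum.inl) (fun t => (N'.Fplus t).map Sum.inr)

/-- The product `s·s'` of a multiset over `α` with a multiset over `β`, as a multiset
over `α ⊕ β`; used for markings and concurrences of a juxtaposition. -/
def mprod {α β : Type} (s : Multiset α) (s' : Multiset β) : Multiset (α ⊕ β) :=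
  s.map Sum.inl + s'.map Sum.inr

theorem Multiset.filterMap_const_none {α β : Type} (s : Multiset α) :
    s.filterMap (fun _ => (none : Option β)) = 0 := by
  induction s using Multiset.induction with
  | empty => simp
  | cons a s ih => rw [Multiset.filterMap_cons_none _ _ rfl, ih]

theorem mprod_injective {α β : Type} :
    Function.Injective (fun p : Multiset α × Multiset β => mprod p.1 p.2) := by
  have hl (s : Multiset α) (s' : Multiset β) :
      (mprod s s').filterMap Sum.getLeft? = s := by
    simp [mprod, Multiset.filterMap_add, Multiset.filterMap_map, Function.comp_def,
      Multiset.filterMap_const_none]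
  have hr (s : Multiset α) (s' : Multiset β) :
      (mprod s s').filterMap Sum.getRight? = s' := by
    simp [mprod, Multiset.filterMap_add, Multiset.filterMap_map, Function.comp_def,
      Multiset.filterMap_const_none]
  rintro ⟨s, s'⟩ ⟨u, u'⟩ h
  ext1
  · simpa only [hl] using congrArg (Multiset.filterMap Sum.getLeft?) h
  · simpa only [hr] using congrArg (Multiset.filterMap Sum.getRight?) h

theorem mprod_surjective {α β : Type} :
    Function.Surjective (fun p : Multiset α × Multiset β => mprod p.1 p.2) := by
  intro s
  induction s using Multiset.induction with
  | empty => exact ⟨(0, 0), by simp [mprod]⟩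
  | cons a s ih =>
    obtain ⟨⟨u, u'⟩, rfl⟩ := ih
    cases a with
    | inl a => exact ⟨(a ::ₘ u, u'), by simp [mprod]⟩
    | inr b => exact ⟨(u, b ::ₘ u'), by simp [mprod]⟩

theorem mprod_bijective {α β : Type} :
    Function.Bijective (fun p : Multiset α × Multiset β => mprod p.1 p.2) :=
  ⟨mprod_injective, mprod_surjective⟩

theorem mprod_inj {α β : Type} {s u : Multiset α} {s' u' : Multiset β} :
    mprod s s' = mprod u u' ↔ s = u ∧ s' = u' :=
  (mprod_injective.eq_iff (a := (s, s')) (b := (u, u'))).trans Prod.mk_inj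

theorem mprod_add_mprod {α β : Type} (s u : Multiset α) (s' u' : Multiset β) :
    mprod s s' + mprod u u' = mprod (s + u) (s' + u') := by
  simp only [mprod, Multiset.map_add]
  abel

theorem mprod_le_mprod {α β : Type} {s u : Multiset α} {s' u' : Multiset β} :
    mprod s s' ≤ mprod u u' ↔ s ≤ u ∧ s' ≤ u' := by
  constructor
  · intro h
    obtain ⟨d, hd⟩ := Multiset.le_iff_exists_add.1 h
    obtain ⟨⟨v, v'⟩, rfl⟩ := mprod_surjective d
    obtain ⟨rfl, rfl⟩ := mprod_inj.1 (hd.trans (mprod_add_mprod s v s' v'))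
    exact ⟨Multiset.le_add_right _ _, Multiset.le_add_right _ _⟩
  · rintro ⟨h, h'⟩
    exact add_le_add (Multiset.map_le_map h) (Multiset.map_le_map h')

theorem mprod_sub_mprod {α β : Type} [DecidableEq α] [DecidableEq β]
    {s u : Multiset α} {s' u' : Multiset β} (h : u ≤ s) (h' : u' ≤ s') :
    mprod s s' - mprod u u' = mprod (s - u) (s' - u') := by
  obtain ⟨v, rfl⟩ := Multiset.le_iff_exists_add.1 h
  obtain ⟨v', rfl⟩ := Multiset.le_iff_exists_add.1 h'
  simp only [← mprod_add_mprod, add_tsub_cancel_left]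

theorem Multiset.sum_map_map {α β γ : Type} (f : α → Multiset β) (g : β → γ) (s : Multiset α) :
    (s.map fun a => (f a).map g).sum = (s.map f).sum.map g := by
  induction s using Multiset.induction with
  | empty => simp
  | cons a s ih => simp [ih]

theorem PTN.inFlow_juxta {P T P' T' : Type} (N : PTN P T) (N' : PTN P' T')
    (t : Multiset T) (t' : Multiset T') :
    (N.juxta N').inFlow (mprod t t') = mprod (N.inFlow t) (N'.inFlow t') := by
  simp [PTN.inFlow, PTN.juxta, mprod, Multiset.sum_map_map]

theorem PTN.outFlow_juxta {P T P' T' : Type} (N : PTN P T) (N' : PTN P' T')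
    (t : Multiset T) (t' : Multiset T') :
    (N.juxta N').outFlow (mprod t t') = mprod (N.outFlow t) (N'.outFlow t') := by
  simp [PTN.outFlow, PTN.juxta, mprod, Multiset.sum_map_map]

/-- **Step characterization of juxtaposed nets.** Every marking of the juxtaposition
splits uniquely as a product `m·m'` (the pairing map is bijective), every concurrence
splits uniquely as `t·t'`, and `(m₁·m₁') →_{t·t'} (m₂·m₂')` holds in the juxtaposition
if and only if `m₁ →_t m₂` holds in `N` and `m₁' →_{t'} m₂'` holds in `N'`. -/
theorem juxta_step_characterization {P T P' T' : Type} [DecidableEq P] [DecidableEq P']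
    (N : PTN P T) (N' : PTN P' T') :
    Function.Bijective (fun p : Multiset P × Multiset P' => mprod p.1 p.2) ∧
    Function.Bijective (fun p : Multiset T × Multiset T' => mprod p.1 p.2) ∧
    (∀ (m₁ m₂ : Multiset P) (m₁' m₂' : Multiset P') (t : Multiset T) (t' : Multiset T'),
      (N.juxta N').Fires (mprod m₁ m₁') (mprod t t') (mprod m₂ m₂') ↔
        N.Fires m₁ t m₂ ∧ N'.Fires m₁' t' m₂') := by
  refine ⟨mprod_bijective, mprod_bijective, fun m₁ m₂ m₁' m₂' t t' => ?_⟩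
  simp only [PTN.Fires, PTN.inFlow_juxta, PTN.outFlow_juxta, mprod_le_mprod]
  rw [and_and_and_comm]
  refine and_congr_right fun ⟨h, h'⟩ => ?_
  rw [mprod_sub_mprod h h', mprod_add_mprod, mprod_inj]
end
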